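/- arXiv:0809.1043 — 5 statements merged into one kernel-verified Lean document; each statement's English description precedes it below -/
import Mathlib

section
/- If a set of codewords W = {w_1, …, w_m}, where each w_i is a finite string over a D-ary alphabet (D ≥ 2) with length l_i, is uniquely decodable in the sense that the concatenation map sending each finite sequence (i_1, …, i_k) of indices from {1, …, m} to the concatenated string w_{i_1} w_{i_2} ⋯ w_{i_k} is injective on all finite sequences, then ∑_{i=1}^m D^{-l_i} ≤ 1. -/
/-- The set of codewords of an injective concatenation map is uniquely decodable. -/
theorem uniquelyDecodable_range_of_flatMap_injective {ι α : Type*} {w : ι → List α}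
    (h : Function.Injective (fun x : List ι => x.flatMap w)) :
    InformationTheory.UniquelyDecodable (Set.range w) := by
  intro L₁ L₂ h₁ h₂ heq
  obtain ⟨x, rfl⟩ : L₁ ∈ Set.range (List.map w) := by rw [Set.range_list_map]; exact h₁
  obtain ⟨y, rfl⟩ : L₂ ∈ Set.range (List.map w) := by rw [Set.range_list_map]; exact h₂
  rw [h (by simpa only [List.flatMap_def] using heq : x.flatMap w = y.flatMap w)]

/-- A code with an injective concatenation map is itself injective. -/
theorem injective_of_flatMap_injective {ι α : Type*} {w : ι → List α}
    (h : Function.Injective (fun x : List ι => x.flatMap w)) : Function.Injective w := by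
  intro i j hij
  have : [i] = [j] := h (by simpa using hij)
  simpa using this


/-- **McMillan's theorem.** If a set of codewords `w 0, …, w (m-1)`, each a nonempty finite
string over a `D`-ary alphabet (`D ≥ 2`), is uniquely decodable in the sense that the
concatenation map on finite sequences of indices is injective, then Kraft's inequality
`∑ i, D ^ (-(length of w i)) ≤ 1` holds. -/
theorem mcmillan (m D : ℕ) (hD : 2 ≤ D)
    (w : Fin m → List (Fin D)) (hw : ∀ i, w i ≠ [])
    (hUD : Function.Injective (fun x : List (Fin m) => x.flatMap w)) :
    ∑ i : Fin m, (D : ℝ) ^ (-((w i).length : ℤ)) ≤ 1 := by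
  have : Nonempty (Fin D) := ⟨⟨0, by lia⟩⟩
  have hS : InformationTheory.UniquelyDecodable
      ((Finset.univ.image w : Finset (List (Fin D))) : Set (List (Fin D))) := by
    simpa using uniquelyDecodable_range_of_flatMap_injective hUD
  have hK := InformationTheory.kraft_mcmillan_inequality hS
  rw [Finset.sum_image (injective_of_flatMap_injective hUD).injOn] at hK
  simpa using hK
end

section
/- Let X be a first-order Markov source on alphabet {1, …, m} with transition probability matrix P (P_{ij} ≥ 0, each row summing to 1), and let W = {w_1, …, w_m} be D-ary codewords with lengths l_i = l(w_i), D ≥ 2. Call a finite sequence (x_1, …, x_k) of symbols producible if P_{x_i x_{i+1}} > 0 for all 1 ≤ i < k. If the code is uniquely decodable for the source X, i.e., the concatenation map (x_1, …, x_k) ↦ w_{x_1} w_{x_2} ⋯ w_{x_k} is injective on the set of all producible finite sequences, then the m×m matrix Q defined by Q_{ij} = 0 if P_{ij} = 0 and Q_{ij} = D^{-l_j} if P_{ij} > 0 has spectral radius at most 1 (all its complex eigenvalues have modulus at most 1). -/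
open Matrix

/-- A finite set of words of length at most `N` over an alphabet `α` has total weight at most
`N + 1`, where a word of length `n` has weight `(card α)⁻¹ ^ n`. -/
lemma sum_inv_card_pow_length_le {α : Type*} [Fintype α] (T : Finset (List α)) (N : ℕ)
    (hT : ∀ x ∈ T, x.length ≤ N) :
    ∑ x ∈ T, (Fintype.card α : ℝ)⁻¹ ^ x.length ≤ N + 1 := by
  have hmaps : ∀ x ∈ T, x.length ∈ Finset.range (N + 1) := fun x hx =>
    Finset.mem_range.2 (Nat.lt_succ_of_le (hT x hx))
  rw [← Finset.sum_fiberwise_of_maps_to hmaps]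
  have hfiber : ∀ n ∈ Finset.range (N + 1),
      ∑ x ∈ T with x.length = n, (Fintype.card α : ℝ)⁻¹ ^ x.length ≤ 1 := by
    intro n _
    have hcard : ((T.filter fun x => x.length = n).card : ℝ) ≤ (Fintype.card α : ℝ) ^ n := by
      exact_mod_cast Finset.card_filter_length_eq_le
    calc ∑ x ∈ T with x.length = n, (Fintype.card α : ℝ)⁻¹ ^ x.length
        = ∑ x ∈ T with x.length = n, (Fintype.card α : ℝ)⁻¹ ^ n :=
          Finset.sum_congr rfl fun x hx => by rw [(Finset.mem_filter.1 hx).2]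
      _ = (T.filter fun x => x.length = n).card * (Fintype.card α : ℝ)⁻¹ ^ n := by
          rw [Finset.sum_const, nsmul_eq_mul]
      _ ≤ (Fintype.card α : ℝ) ^ n * (Fintype.card α : ℝ)⁻¹ ^ n := by gcongr
      _ = ((Fintype.card α : ℝ) * (Fintype.card α : ℝ)⁻¹) ^ n := (mul_pow _ _ _).symm
      _ ≤ 1 := pow_le_one₀ (by positivity) mul_inv_le_one
  simpa using Finset.sum_le_sum hfiber

section Walks

variable {α : Type*} [Fintype α] [DecidableEq α] (r : α → α → Prop) [DecidableRel r]

/-- The lists of `k + 1` elements starting at `i` whose consecutive elements are related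
by `r`. -/
def walksFrom : ℕ → α → Finset (List α)
  | 0, i => {[i]}
  | k + 1, i => (Finset.univ.filter (r i)).biUnion fun j => (walksFrom k j).image (List.cons i)

variable {r}

lemma exists_cons_of_mem_walksFrom {k : ℕ} {i : α} {x : List α} (hx : x ∈ walksFrom r k i) :
    ∃ t, x = i :: t := by
  cases k with
  | zero => exact ⟨[], by simpa [walksFrom] using hx⟩
  | succ k =>
    simp only [walksFrom, Finset.mem_biUnion, Finset.mem_image] at hx
    obtain ⟨_, _, t, _, rfl⟩ := hx
    exact ⟨t, rfl⟩

lemma length_of_mem_walksFrom {k : ℕ} {i : α} {x : List α} (hx : x ∈ walksFrom r k i) :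
    x.length = k + 1 := by
  induction k generalizing i x with
  | zero => simp_all [walksFrom]
  | succ k ih =>
    simp only [walksFrom, Finset.mem_biUnion, Finset.mem_image] at hx
    obtain ⟨_, _, t, ht, rfl⟩ := hx
    simp [ih ht]

lemma isChain_of_mem_walksFrom {k : ℕ} {i : α} {x : List α} (hx : x ∈ walksFrom r k i) :
    x.IsChain r := by
  induction k generalizing i x with
  | zero => simp_all [walksFrom]
  | succ k ih =>
    simp only [walksFrom, Finset.mem_biUnion, Finset.mem_image, Finset.mem_filter,
      Finset.mem_univ, true_and] at hx
    obtain ⟨j, hij, t, ht, rfl⟩ := hx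
    obtain ⟨s, rfl⟩ := exists_cons_of_mem_walksFrom ht
    exact List.isChain_cons_cons.2 ⟨hij, ih ht⟩

lemma sum_prod_walksFrom_succ {R : Type*} [CommSemiring R] (f : α → R) (k : ℕ) (i : α) :
    ∑ x ∈ walksFrom r (k + 1) i, (x.map f).prod =
      f i * ∑ j with r i j, ∑ x ∈ walksFrom r k j, (x.map f).prod := by
  rw [walksFrom, Finset.sum_biUnion, Finset.mul_sum]
  · refine Finset.sum_congr rfl fun j _ => ?_
    rw [Finset.sum_image (by simp), Finset.mul_sum]
    simp
  · intro j _ j' _ hjj'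
    refine Finset.disjoint_left.2 fun x hx hx' => hjj' ?_
    obtain ⟨t, ht, rfl⟩ := Finset.mem_image.1 hx
    obtain ⟨t', ht', h⟩ := Finset.mem_image.1 hx'
    obtain ⟨s, rfl⟩ := exists_cons_of_mem_walksFrom ht
    obtain ⟨s', rfl⟩ := exists_cons_of_mem_walksFrom ht'
    simp_all

/-- Iterating the inequality `c * u i ≤ ∑ f j * u j`, the sum being over the `j` related to `i`,
bounds the growth of `c ^ k` by the total weight of the walks with `k` steps. -/
lemma mul_pow_le_sum_walksFrom {f u : α → ℝ} {c M : ℝ} (hf : ∀ i, 0 ≤ f i) (hc : 0 ≤ c)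
    (hM : ∀ i, u i ≤ M) (hu : ∀ i, c * u i ≤ ∑ j with r i j, f j * u j) (k : ℕ) (i : α) :
    f i * u i * c ^ k ≤ M * ∑ x ∈ walksFrom r k i, (x.map f).prod := by
  induction k generalizing i with
  | zero => simpa [walksFrom, mul_comm] using mul_le_mul_of_nonneg_right (hM i) (hf i)
  | succ k ih =>
    calc f i * u i * c ^ (k + 1) = f i * c ^ k * (c * u i) := by ring
      _ ≤ f i * c ^ k * ∑ j with r i j, f j * u j :=
          mul_le_mul_of_nonneg_left (hu i) (mul_nonneg (hf i) (pow_nonneg hc k))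
      _ = f i * ∑ j with r i j, f j * u j * c ^ k := by
          rw [← Finset.sum_mul]; ring
      _ ≤ f i * ∑ j with r i j, M * ∑ x ∈ walksFrom r k j, (x.map f).prod :=
          mul_le_mul_of_nonneg_left (Finset.sum_le_sum fun j _ => ih j) (hf i)
      _ = M * ∑ x ∈ walksFrom r (k + 1) i, (x.map f).prod := by
          rw [sum_prod_walksFrom_succ, ← Finset.mul_sum]; ring

/-- If concatenation of codewords is injective on `r`-chains, then the total weight of the walks
with `k` steps grows at most linearly in `k`. -/
lemma sum_walksFrom_le_of_injOn_flatMap {β : Type*} [Fintype β] {w : α → List β}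
    (hw : Set.InjOn (fun x : List α => x.flatMap w) {x | x.IsChain r}) {L : ℕ}
    (hL : ∀ i, (w i).length ≤ L) (k : ℕ) (i : α) :
    ∑ x ∈ walksFrom r k i, (x.map fun a => (Fintype.card β : ℝ)⁻¹ ^ (w a).length).prod ≤
      (k + 1) * L + 1 := by
  classical
  have hprod (x : List α) : (x.map fun a => (Fintype.card β : ℝ)⁻¹ ^ (w a).length).prod =
      (Fintype.card β : ℝ)⁻¹ ^ (x.flatMap w).length := by
    induction x with
    | nil => simp
    | cons a x ih =>
      rw [List.map_cons, List.prod_cons, ih, List.flatMap_cons, List.length_append, pow_add]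
  have hlen (x : List α) : (x.flatMap w).length ≤ x.length * L := by
    induction x with
    | nil => simp
    | cons a x ih =>
      rw [List.flatMap_cons, List.length_append, List.length_cons, add_mul, one_mul, add_comm]
      exact add_le_add ih (hL a)
  have hinj : Set.InjOn (fun x : List α => x.flatMap w) (walksFrom r k i : Set (List α)) :=
    hw.mono fun x hx => isChain_of_mem_walksFrom (Finset.mem_coe.1 hx)
  have key := sum_inv_card_pow_length_le
    ((walksFrom r k i).image fun x : List α => x.flatMap w) ((k + 1) * L) (by
      intro y hy
      obtain ⟨x, hx, rfl⟩ := Finset.mem_image.1 hy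
      exact (hlen x).trans_eq (by rw [length_of_mem_walksFrom hx]))
  rw [Finset.sum_image hinj] at key
  simp only [hprod]
  exact_mod_cast key

end Walks

/-- A real number whose powers grow at most linearly is at most `1`. -/
lemma le_one_of_mul_pow_le_linear {a b d c : ℝ} (ha : 0 < a)
    (h : ∀ k : ℕ, a * c ^ k ≤ b * k + d) : c ≤ 1 := by
  by_contra! hc
  have h0 := tendsto_pow_const_div_const_pow_of_one_lt 0 hc
  have h1 := tendsto_pow_const_div_const_pow_of_one_lt 1 hc
  have hlim := (h1.const_mul b).add (h0.const_mul d)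
  have hle : a ≤ b * 0 + d * 0 := by
    refine ge_of_tendsto' hlim fun k => ?_
    have hpos : 0 < c ^ k := pow_pos (zero_lt_one.trans hc) k
    rw [pow_one, pow_zero, ← mul_div_assoc, ← mul_div_assoc, ← add_div, le_div_iff₀ hpos, mul_one]
    exact h k
  linarith

/-- **Extension of McMillan's theorem to first-order Markov sources (Theorem 2).**
Let `X` be a first-order Markov source on `{1, …, m}` with transition probability matrix `P`
(nonnegative entries, rows summing to 1), and let `w 0, …, w (m-1)` be `D`-ary codewords
(`D ≥ 2`) with lengths `l i`.  A finite sequence is producible if all its consecutive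
transitions have positive probability.  If the code is uniquely decodable for `X`, i.e. the
concatenation map is injective on producible finite sequences, then the matrix `Q` with
`Q i j = D ^ (-l j)` when `P i j > 0` and `Q i j = 0` otherwise has spectral radius at most 1:
every complex eigenvalue of `Q` has modulus at most 1. -/
theorem mcmillan_markov (m D : ℕ) (hD : 2 ≤ D)
    (P : Matrix (Fin m) (Fin m) ℝ)
    (hPnonneg : ∀ i j, 0 ≤ P i j) (hProw : ∀ i, ∑ j, P i j = 1)
    (w : Fin m → List (Fin D)) (hw : ∀ i, w i ≠ [])
    (l : Fin m → ℕ) (hl : ∀ i, l i = (w i).length)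
    (hUD : Set.InjOn (fun x : List (Fin m) => x.flatMap w)
      {x : List (Fin m) | x.Chain' fun a b => 0 < P a b})
    (Q : Matrix (Fin m) (Fin m) ℝ)
    (hQ : ∀ i j, Q i j = if 0 < P i j then (D : ℝ) ^ (-(l j : ℤ)) else 0) :
    ∀ μ ∈ spectrum ℂ (Q.map Complex.ofReal), ‖μ‖ ≤ 1 := by
  classical
  intro μ hμ
  rw [← Matrix.spectrum_toLin', ← Module.End.hasEigenvalue_iff_mem_spectrum] at hμ
  obtain ⟨v, hv⟩ := hμ.exists_hasEigenvector
  obtain ⟨i, hi⟩ := Function.ne_iff.1 hv.2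
  have hDpos : (0 : ℝ) < D := by exact_mod_cast (by omega : 0 < D)
  set f : Fin m → ℝ := fun a => (Fintype.card (Fin D) : ℝ)⁻¹ ^ (w a).length with hf
  have hfpos (a : Fin m) : 0 < f a := by simp only [hf, Fintype.card_fin]; positivity
  have hQf (a b : Fin m) : Q a b = if 0 < P a b then f b else 0 := by
    simp [hQ, hf, hl]
  have hu (a : Fin m) : ‖μ‖ * ‖v a‖ ≤ ∑ b with 0 < P a b, f b * ‖v b‖ := by
    have hva : ∑ b, (Q a b : ℂ) * v b = μ * v a := by
      simpa [Matrix.mulVec, dotProduct] using congrFun hv.apply_eq_smul a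
    rw [← norm_mul, ← hva, Finset.sum_filter]
    refine (norm_sum_le _ _).trans_eq (Finset.sum_congr rfl fun b _ => ?_)
    rw [norm_mul, Complex.norm_real, hQf]
    split_ifs
    · rw [Real.norm_of_nonneg (hfpos b).le]
    · simp
  have hL (a : Fin m) : (w a).length ≤ ∑ b, (w b).length :=
    Finset.single_le_sum (f := fun b => (w b).length) (fun _ _ => Nat.zero_le _)
      (Finset.mem_univ a)
  refine le_one_of_mul_pow_le_linear (mul_pos (hfpos i) (norm_pos_iff.2 hi))
    (b := ‖v‖ * (∑ b, (w b).length : ℕ)) (d := ‖v‖ * ((∑ b, (w b).length : ℕ) + 1)) fun k => ?_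
  calc f i * ‖v i‖ * ‖μ‖ ^ k
      ≤ ‖v‖ * ∑ x ∈ walksFrom (fun a b => 0 < P a b) k i, (x.map f).prod :=
        mul_pow_le_sum_walksFrom (u := fun a => ‖v a‖) (fun a => (hfpos a).le) (norm_nonneg μ)
          (norm_le_pi_norm v) hu k i
    _ ≤ ‖v‖ * ((k + 1) * (∑ b, (w b).length : ℕ) + 1) :=
        mul_le_mul_of_nonneg_left (sum_walksFrom_le_of_injOn_flatMap hUD hL k i) (norm_nonneg v)
    _ = _ := by ring
end

section
/- For the stationary Markov source X on {A,B,C,D} and the alternative code w(A)=0, w(B)=1, w(C)=01, w(D)=10: (i) the concatenation map (x_1,…,x_n) ↦ w(x_1)⋯w(x_n) is injective on the set of producible finite sequences, and (ii) for every n ≥ 1, the expected code length ∑_{producible (x_1,…,x_n)} p(x_1,…,x_n)·(l(x_1)+⋯+l(x_n)) is strictly smaller than the joint entropy H(X_1,…,X_n) = ∑_{producible (x_1,…,x_n)} p(x_1,…,x_n)·log₂(1/p(x_1,…,x_n)), where l(A)=l(B)=1 and l(C)=l(D)=2. -/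
/-- Transition probability matrix of the stationary Markov source on `{A,B,C,D}`
(encoded as `0,1,2,3`). -/
noncomputable def P : Fin 4 → Fin 4 → ℝ :=
  ![![1/2, 0, 1/2, 0],
    ![0, 1/2, 0, 1/2],
    ![1/4, 1/4, 1/4, 1/4],
    ![1/4, 1/4, 1/4, 1/4]]

/-- Probability of the length-`n` sequence `x`: uniform initial distribution (`1/4`)
times the product of the transition probabilities. -/
noncomputable def p (n : ℕ) (x : Fin n → Fin 4) : ℝ :=
  (1 / 4) * ∏ i : Fin n, if h : (i : ℕ) + 1 < n then P (x i) (x ⟨(i : ℕ) + 1, h⟩) else 1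

/-- The alternative code: `A→0, B→1, C→01, D→10`. -/
def w : Fin 4 → List (Fin 2) := ![[0], [1], [0, 1], [1, 0]]

/-- Codeword lengths of the alternative code: `l(A)=l(B)=1`, `l(C)=l(D)=2`. -/
def l : Fin 4 → ℕ := ![1, 1, 2, 2]

theorem P_eq_of_pos {a b : Fin 4} (h : 0 < P a b) : P a b = (1 / 2) ^ l a := by
  fin_cases a <;> fin_cases b <;> simp [P, l] at h ⊢ <;> norm_num

theorem P_nonneg (a b : Fin 4) : 0 ≤ P a b := by
  fin_cases a <;> fin_cases b <;> simp [P]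

theorem p_succ (m : ℕ) (x : Fin (m + 1) → Fin 4) :
    p (m + 1) x = 1 / 4 * ∏ i : Fin m, P (x i.castSucc) (x i.succ) := by
  rw [p, Fin.prod_univ_castSucc]
  simp [Fin.succ]

theorem p_eq_of_pos {m : ℕ} {x : Fin (m + 1) → Fin 4} (h : 0 < p (m + 1) x) :
    p (m + 1) x = (1 / 2) ^ (2 + ∑ i : Fin m, l (x i.castSucc)) := by
  rw [p_succ] at h ⊢
  have hprod : ∏ i : Fin m, P (x i.castSucc) (x i.succ) ≠ 0 := right_ne_zero_of_mul h.ne'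
  rw [Finset.prod_ne_zero_iff] at hprod
  rw [Finset.prod_congr rfl fun i hi =>
    P_eq_of_pos ((P_nonneg _ _).lt_of_ne' (hprod i hi)), Finset.prod_pow_eq_pow_sum, pow_add]
  norm_num

/-- The self-information of a producible sequence is `2` bits plus the code length of all
symbols but the last. -/
theorem logb_one_div_p {m : ℕ} {x : Fin (m + 1) → Fin 4} (h : 0 < p (m + 1) x) :
    Real.logb 2 (1 / p (m + 1) x) = 2 + ∑ i : Fin m, (l (x i.castSucc) : ℝ) := by
  rw [p_eq_of_pos h, ← one_div_pow, one_div_one_div, Real.logb_pow,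
    Real.logb_self_eq_one one_lt_two]
  push_cast
  ring

theorem l_le_two (a : Fin 4) : l a ≤ 2 := by
  fin_cases a <;> simp [l]

theorem p_const_zero_pos (m : ℕ) : 0 < p (m + 1) fun _ => 0 := by
  simp [p_succ, P]

/-- Two producible sequences with the same encoding have the same first symbol. -/
theorem head_eq_of_flatMap_w_eq {a b : Fin 4} {x y : List (Fin 4)}
    (hx : (a :: x).IsChain fun a b => 0 < P a b) (hy : (b :: y).IsChain fun a b => 0 < P a b)
    (h : (a :: x).flatMap w = (b :: y).flatMap w) : a = b := by
  rcases x with _ | ⟨c, x⟩ <;> rcases y with _ | ⟨d, y⟩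
  · fin_cases a <;> fin_cases b <;> simp [w] at h ⊢
  · fin_cases a <;> fin_cases b <;> simp [w] at h ⊢ <;>
      fin_cases d <;> simp [P] at h hy
  · fin_cases a <;> fin_cases b <;> simp [w] at h ⊢ <;>
      fin_cases c <;> simp [P] at h hx
  · fin_cases a <;> fin_cases b <;> simp [w] at h ⊢ <;>
      fin_cases c <;> simp [P] at h hx <;> fin_cases d <;> simp [P] at h hy

theorem w_ne_nil (a : Fin 4) : w a ≠ [] := by
  fin_cases a <;> simp [w]

theorem injOn_flatMap_w :
    Set.InjOn (fun x : List (Fin 4) => x.flatMap w)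
      {x : List (Fin 4) | x.IsChain fun a b => 0 < P a b} := by
  intro x
  induction x with
  | nil =>
    rintro - (_ | ⟨b, y⟩) - h
    · rfl
    · simp [w_ne_nil] at h
  | cons a x ih =>
    rintro hx (_ | ⟨b, y⟩) hy h
    · simp [w_ne_nil] at h
    · obtain rfl := head_eq_of_flatMap_w_eq hx hy h
      exact congrArg (a :: ·) (ih (List.IsChain.tail hx) (List.IsChain.tail hy) (by simpa using h))

/-- **Lemma 1 of the paper.** For the stationary Markov source on `{A,B,C,D}` and the
alternative code `A→0, B→1, C→01, D→10`:
(i) the concatenation map is injective on the set of producible finite sequences, and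
(ii) for every `n ≥ 1` the expected code length of the first `n` symbols is strictly smaller
than their joint entropy `H(X₁,…,Xₙ)`. -/
theorem alternative_code_beats_entropy :
    (Set.InjOn (fun x : List (Fin 4) => x.flatMap w)
      {x : List (Fin 4) | x.Chain' fun a b => 0 < P a b}) ∧
    (∀ n : ℕ, 1 ≤ n →
      ∑ x ∈ Finset.univ.filter (fun x : Fin n → Fin 4 => 0 < p n x),
          p n x * (∑ i : Fin n, (l (x i) : ℝ))
        < ∑ x ∈ Finset.univ.filter (fun x : Fin n → Fin 4 => 0 < p n x),
            p n x * Real.logb 2 (1 / p n x)) := by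
  refine ⟨injOn_flatMap_w, fun n hn => ?_⟩
  obtain ⟨m, rfl⟩ := Nat.exists_eq_add_of_le' hn
  refine Finset.sum_lt_sum (fun x hx => ?_)
    ⟨fun _ => 0, by simpa using p_const_zero_pos m, ?_⟩
  · have hpos : 0 < p (m + 1) x := by simpa using hx
    have hl : (l (x (Fin.last m)) : ℝ) ≤ 2 := mod_cast l_le_two _
    rw [logb_one_div_p hpos, Fin.sum_univ_castSucc]
    exact mul_le_mul_of_nonneg_left (by linarith) hpos.le
  · rw [logb_one_div_p (p_const_zero_pos m), Fin.sum_univ_castSucc]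
    refine mul_lt_mul_of_pos_left ?_ (p_const_zero_pos m)
    have hl : (l 0 : ℝ) = 1 := by simp [l]
    linarith
end

section
/- For the stationary Markov source X on {A,B,C,D}, the concatenation map sending each producible finite sequence (x_1,…,x_n) to the bit string w(x_1)w(x_2)⋯w(x_n), where w(A)=0, w(B)=1, w(C)=01, w(D)=10, is injective on the set of all producible finite sequences; that is, no two distinct producible finite sequences are mapped to the same bit string. -/
/-- The first symbol of a nonempty producible sequence, read off the first two bits of its
encoding. -/
def firstSymbol : List (Fin 2) → Fin 4
  | 0 :: 1 :: _ => 2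
  | 1 :: 0 :: _ => 3
  | 1 :: _ => 1
  | _ => 0

theorem firstSymbol_flatMap_w {a : Fin 4} {s : List (Fin 4)}
    (h : (a :: s).IsChain fun a b => 0 < P a b) : firstSymbol ((a :: s).flatMap w) = a := by
  rcases s with _ | ⟨b, s⟩
  · fin_cases a <;> rfl
  · have hab : 0 < P a b := (List.isChain_cons_cons.mp h).1
    fin_cases a <;> fin_cases b <;> first | rfl | simp [P] at hab

/-- **Unique decodability of the alternative code for the source.** The concatenation map
sending each producible finite sequence of symbols (one in which every consecutive transition
has positive probability) to the concatenation of its codewords is injective on the set of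
producible finite sequences: no two distinct producible sequences get the same bit string. -/
theorem alternative_code_uniquely_decodable :
    Set.InjOn (fun x : List (Fin 4) => x.flatMap w)
      {x : List (Fin 4) | x.Chain' fun a b => 0 < P a b} := by
  intro x hx y hy hxy
  simp only [Set.mem_ofPred_eq] at hx hy hxy
  induction x generalizing y with
  | nil =>
    cases y with
    | nil => rfl
    | cons b t => simp [w_ne_nil] at hxy
  | cons a s ih =>
    cases y with
    | nil => simp [w_ne_nil] at hxy
    | cons b t =>
      obtain rfl : a = b := by
        rw [← firstSymbol_flatMap_w hx, hxy, firstSymbol_flatMap_w hy]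
      rw [List.flatMap_cons, List.flatMap_cons] at hxy
      exact congrArg (a :: ·) (ih hx.tail hy.tail (List.append_cancel_left hxy))
end

section
/- Let Q be an m×m real matrix with nonnegative entries, let L and u be column vectors with strictly positive real entries, and suppose there is a constant C > 0 such that Lᵀ Q^{k−1} u ≤ C·k for every integer k ≥ 1. Then the spectral radius of Q is at most 1. -/
open Matrix

/-- A real number whose powers grow at most linearly is at most one. -/
theorem le_one_of_pow_mul_le_linear {r a B : ℝ} (ha : 0 < a)
    (h : ∀ k : ℕ, r ^ k * a ≤ B * (k + 1 : ℕ)) : r ≤ 1 := by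
  by_contra! hr
  have hr0 : 0 < r := one_pos.trans hr
  have hlim := (((tendsto_pow_const_div_const_pow_of_one_lt 1 hr).comp
    (Filter.tendsto_add_atTop_nat 1)).const_mul B)
  rw [mul_zero] at hlim
  have hle : a / r ≤ 0 := by
    refine ge_of_tendsto' hlim fun k => ?_
    have hk := h k
    simp only [Function.comp_apply, pow_one]
    rw [← mul_div_assoc, div_le_div_iff₀ hr0 (pow_pos hr0 _), pow_succ]
    nlinarith
  exact hle.not_gt (div_pos ha hr0)

namespace Matrix

variable {n : Type*} [Fintype n]

theorem mulVec_mono_of_nonneg {A : Matrix n n ℝ} (hA : ∀ i j, 0 ≤ A i j) {x y : n → ℝ}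
    (hxy : x ≤ y) : A *ᵥ x ≤ A *ᵥ y := fun i =>
  Finset.sum_le_sum fun j _ => mul_le_mul_of_nonneg_left (hxy j) (hA i j)

/-- The moduli of the entries of a complex eigenvector of a nonnegative matrix form a
subinvariant vector for every power of the matrix. -/
theorem norm_pow_smul_norm_le_pow_mulVec [DecidableEq n] {A : Matrix n n ℝ}
    (hA : ∀ i j, 0 ≤ A i j) {μ : ℂ} {v : n → ℂ} (hv : A.map Complex.ofReal *ᵥ v = μ • v) (k : ℕ) :
    ‖μ‖ ^ k • (fun i => ‖v i‖) ≤ A ^ k *ᵥ fun i => ‖v i‖ := by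
  have hstep : ‖μ‖ • (fun i => ‖v i‖) ≤ A *ᵥ fun i => ‖v i‖ := fun i => by
    calc ‖μ‖ * ‖v i‖ = ‖(A.map Complex.ofReal *ᵥ v) i‖ := by rw [hv]; simp
      _ ≤ ∑ j, ‖(A i j : ℂ) * v j‖ := norm_sum_le _ _
      _ = ∑ j, A i j * ‖v j‖ := Finset.sum_congr rfl fun j _ => by
        rw [norm_mul, Complex.norm_of_nonneg (hA i j)]
  induction k with
  | zero => simp
  | succ k ih =>
    calc ‖μ‖ ^ (k + 1) • (fun i => ‖v i‖) = ‖μ‖ ^ k • ‖μ‖ • (fun i => ‖v i‖) := by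
          rw [pow_succ, mul_smul]
      _ ≤ ‖μ‖ ^ k • (A *ᵥ fun i => ‖v i‖) := smul_le_smul_of_nonneg_left hstep (by positivity)
      _ = A *ᵥ (‖μ‖ ^ k • fun i => ‖v i‖) := (mulVec_smul _ _ _).symm
      _ ≤ A *ᵥ (A ^ k *ᵥ fun i => ‖v i‖) := mulVec_mono_of_nonneg hA ih
      _ = A ^ (k + 1) *ᵥ fun i => ‖v i‖ := by rw [mulVec_mulVec, pow_succ']

theorem pow_apply_nonneg_of_nonneg [DecidableEq n] {A : Matrix n n ℝ} (hA : ∀ i j, 0 ≤ A i j)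
    (k : ℕ) (i j : n) : 0 ≤ (A ^ k) i j := by
  induction k generalizing i j with
  | zero => rw [pow_zero, one_apply]; positivity
  | succ k ih =>
    rw [pow_succ, mul_apply]
    exact Finset.sum_nonneg fun l _ => mul_nonneg (ih i l) (hA l j)

end Matrix

/-- **The spectral growth argument concluding the proof of Theorem 2.** Let `Q` be an
`m × m` real matrix with nonnegative entries and let `L` and `u` be vectors with strictly
positive entries.  If there is a constant `C > 0` with `Lᵀ Q^(k-1) u ≤ C·k` for every `k ≥ 1`,
then the spectral radius of `Q` is at most 1: every complex eigenvalue of `Q` has modulus at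
most 1. -/
theorem spectralRadius_le_one_of_linear_growth (m : ℕ)
    (Q : Matrix (Fin m) (Fin m) ℝ) (hQ : ∀ i j, 0 ≤ Q i j)
    (L u : Fin m → ℝ) (hL : ∀ i, 0 < L i) (hu : ∀ i, 0 < u i)
    (C : ℝ) (hC : 0 < C)
    (hgrowth : ∀ k : ℕ, 1 ≤ k → L ⬝ᵥ ((Q ^ (k - 1)) *ᵥ u) ≤ C * k) :
    ∀ μ ∈ spectrum ℂ (Q.map Complex.ofReal), ‖μ‖ ≤ 1 := by
  intro μ hμ
  rw [← Matrix.spectrum_toLin', ← Module.End.hasEigenvalue_iff_mem_spectrum] at hμ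
  obtain ⟨v, hv⟩ := hμ.exists_hasEigenvector
  have hQv : Q.map Complex.ofReal *ᵥ v = μ • v := hv.apply_eq_smul
  obtain ⟨i, hi⟩ := Function.ne_iff.mp hv.2
  obtain ⟨K, hK0, hK⟩ : ∃ K : ℝ, 0 ≤ K ∧ (fun j => ‖v j‖) ≤ K • u := by
    have hnonneg : ∀ j, 0 ≤ ‖v j‖ / u j := fun j => div_nonneg (norm_nonneg _) (hu j).le
    refine ⟨∑ j, ‖v j‖ / u j, Finset.sum_nonneg fun j _ => hnonneg j, fun j => ?_⟩
    exact (div_le_iff₀ (hu j)).mp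
      (Finset.single_le_sum (fun l _ => hnonneg l) (Finset.mem_univ j))
  refine le_one_of_pow_mul_le_linear (a := L i * ‖v i‖) (B := K * C)
    (mul_pos (hL i) (norm_pos_iff.mpr hi)) fun k => ?_
  have hQk := Matrix.pow_apply_nonneg_of_nonneg hQ k
  have hQu : ∀ j, 0 ≤ (Q ^ k *ᵥ u) j := fun j =>
    dotProduct_nonneg_of_nonneg (hQk j) fun l => (hu l).le
  have hvi : ‖μ‖ ^ k * ‖v i‖ ≤ K * (Q ^ k *ᵥ u) i :=
    calc ‖μ‖ ^ k * ‖v i‖ ≤ (Q ^ k *ᵥ fun j => ‖v j‖) i :=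
          Matrix.norm_pow_smul_norm_le_pow_mulVec hQ hQv k i
      _ ≤ (Q ^ k *ᵥ (K • u)) i := Matrix.mulVec_mono_of_nonneg hQk hK i
      _ = K * (Q ^ k *ᵥ u) i := by rw [mulVec_smul]; rfl
  calc ‖μ‖ ^ k * (L i * ‖v i‖) = L i * (‖μ‖ ^ k * ‖v i‖) := by ring
    _ ≤ L i * (K * (Q ^ k *ᵥ u) i) := mul_le_mul_of_nonneg_left hvi (hL i).le
    _ = K * (L i * (Q ^ k *ᵥ u) i) := by ring
    _ ≤ K * (L ⬝ᵥ (Q ^ k *ᵥ u)) := mul_le_mul_of_nonneg_left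
        (Finset.single_le_sum (f := fun j => L j * (Q ^ k *ᵥ u) j)
          (fun j _ => mul_nonneg (hL j).le (hQu j)) (Finset.mem_univ i)) hK0
    _ ≤ K * (C * (k + 1 : ℕ)) :=
        mul_le_mul_of_nonneg_left (hgrowth (k + 1) (Nat.le_add_left 1 k)) hK0
    _ = K * C * (k + 1 : ℕ) := (mul_assoc _ _ _).symm
end
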